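/- For every integer n ≥ 2, the total number of added edges of type I that are admissible for the directed path →P_{2^n−1} equals 3^n − 3·2^n + 3, which is 2(S(n+1,3) − S(n,2)) in terms of Stirling numbers of the second kind. -/

import Mathlib

/-- A directed graph on a subset of ℕ. -/
structure DGraph where
  verts : Set ℕ
  edges : Set (ℕ × ℕ)

/-- `l` is a directed walk in `G` from `u` to `v`. -/
def IsWalkFrom (G : DGraph) (u v : ℕ) (l : List ℕ) : Prop :=
  l.head? = some u ∧ l.getLast? = some v ∧
    l.Chain' (fun a b => (a, b) ∈ G.edges) ∧ ∀ x ∈ l, x ∈ G.verts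

/-- A `k`-ranking of `G`: labels in `{1,…,k}` and every directed path joining two
vertices with the same label contains a vertex with a larger label. -/
def IsRanking (G : DGraph) (k : ℕ) (f : ℕ → ℕ) : Prop :=
  (∀ v ∈ G.verts, 1 ≤ f v ∧ f v ≤ k) ∧
    ∀ u ∈ G.verts, ∀ v ∈ G.verts, u ≠ v → f u = f v →
      ∀ l : List ℕ, IsWalkFrom G u v l → ∃ x ∈ l, f u < f x

/-- The rank number `χ_r(G)`. -/
noncomputable def rankNumber (G : DGraph) : ℕ := sInf {k | ∃ f : ℕ → ℕ, IsRanking G k f}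

def pathEdges (η : ℕ) : Set (ℕ × ℕ) := {p | ∃ i, 1 ≤ i ∧ i + 1 ≤ η ∧ p = (i, i + 1)}

/-- The directed path `→P_η` on vertices `1,…,η`. -/
def pathP (η : ℕ) : DGraph := ⟨Set.Icc 1 η, pathEdges η⟩

/-- The directed cycle `→C_η` on vertices `1,…,η`. -/
def cycleC (η : ℕ) : DGraph := ⟨Set.Icc 1 η, pathEdges η ∪ {(η, 1)}⟩

/-- Add a single directed edge to a digraph. -/
def addEdge (G : DGraph) (e : ℕ × ℕ) : DGraph := ⟨G.verts, insert e G.edges⟩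

/-- The standard label of vertex `i`: `α + 1` where `2^α` is the largest power
of 2 dividing `i`. -/
def stdLabel (i : ℕ) : ℕ := padicValNat 2 i + 1

/-- Edge set of the direct sum graph of type I, `→G_n`. -/
def edgesI : ℕ → Set (ℕ × ℕ)
  | 0 => ∅
  | 1 => ∅
  | 2 => {(1, 2), (2, 3)}
  | n + 3 =>
      edgesI (n + 2) ∪
      (fun p : ℕ × ℕ => (p.1 + 2 ^ (n + 2), p.2 + 2 ^ (n + 2))) '' edgesI (n + 2) ∪
      {(2 ^ (n + 2) - 1, 2 ^ (n + 2)), (2 ^ (n + 2), 2 ^ (n + 2) + 1)} ∪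
      {p | ∃ j, 1 ≤ j ∧ j ≤ 2 ^ (n + 2) - 2 ∧ p = (j, 2 ^ (n + 2))} ∪
      {p | ∃ j, 2 ≤ j ∧ j ≤ 2 ^ (n + 2) - 1 ∧ p = (2 ^ (n + 2), 2 ^ (n + 2) + j)} ∪
      (fun p : ℕ × ℕ => (p.1, p.2 + 2 ^ (n + 2))) '' edgesI (n + 2)

/-- Edge set of the direct sum graph of type II, `←G_n`. -/
def edgesII : ℕ → Set (ℕ × ℕ)
  | 0 => ∅
  | 1 => ∅
  | 2 => {(1, 2), (2, 3), (2, 1), (3, 2)}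
  | n + 3 =>
      edgesII (n + 2) ∪
      (fun p : ℕ × ℕ => (p.1 + 2 ^ (n + 2), p.2 + 2 ^ (n + 2))) '' edgesII (n + 2) ∪
      {(2 ^ (n + 2) - 1, 2 ^ (n + 2)), (2 ^ (n + 2), 2 ^ (n + 2) + 1)} ∪
      {p | ∃ j, 1 ≤ j ∧ j ≤ 2 ^ (n + 2) - 1 ∧ p = (2 ^ (n + 2), j)} ∪
      {p | ∃ j, 1 ≤ j ∧ j ≤ 2 ^ (n + 2) - 1 ∧ p = (2 ^ (n + 2) + j, 2 ^ (n + 2))}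

/-- The direct sum graph of type I, `→G_n`. -/
def GI (n : ℕ) : DGraph := ⟨Set.Icc 1 (2 ^ n - 1), edgesI n⟩

/-- The direct sum graph of type II, `←G_n`. -/
def GII (n : ℕ) : DGraph := ⟨Set.Icc 1 (2 ^ n - 1), edgesII n⟩

/-- The graph `→Ω_{2^k}`. -/
def OmegaI (k : ℕ) : DGraph :=
  ⟨Set.Icc 1 (2 ^ k),
    (cycleC (2 ^ k)).edges ∪ (edgesI k \ pathEdges (2 ^ k - 1)) ∪
      {p | ∃ i, 2 ≤ i ∧ i ≤ 2 ^ k - 2 ∧ p = (2 ^ k, i)}⟩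

/-- The graph `←Ω_{2^k}`. -/
def OmegaII (k : ℕ) : DGraph :=
  ⟨Set.Icc 1 (2 ^ k),
    (cycleC (2 ^ k)).edges ∪ (edgesII k \ pathEdges (2 ^ k - 1)) ∪
      {p | ∃ i, 2 ≤ i ∧ i ≤ 2 ^ k - 2 ∧ p = (i, 2 ^ k)}⟩

/-- Stirling numbers of the second kind. -/
def stirling : ℕ → ℕ → ℕ
  | 0, 0 => 1
  | 0, _ + 1 => 0
  | _ + 1, 0 => 0
  | n + 1, k + 1 => (k + 1) * stirling n (k + 1) + stirling n k

/-- Attach the directed path `→P_j^{v_i}` (directed toward `vi`) to `G`,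
using `w 1, …, w (j-1)` as the new vertices and `vi` in place of `w j`. -/
def attachFwd (G : DGraph) (vi j : ℕ) (w : ℕ → ℕ) : DGraph :=
  ⟨G.verts ∪ w '' Set.Icc 1 (j - 1),
    G.edges ∪ {p | ∃ l, 1 ≤ l ∧ l + 1 ≤ j ∧
      p = (w l, if l + 1 = j then vi else w (l + 1))}⟩

/-- Attach the directed path `←P_j^{v_i}` (directed away from `vi`) to `G`. -/
def attachBwd (G : DGraph) (vi j : ℕ) (w : ℕ → ℕ) : DGraph :=
  ⟨G.verts ∪ w '' Set.Icc 1 (j - 1),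
    G.edges ∪ {p | ∃ l, 1 ≤ l ∧ l + 1 ≤ j ∧
      p = ((if l + 1 = j then vi else w (l + 1)), w l)}⟩

/-- The set of added edges of type I that are admissible for `→P_{2^n−1}`. -/
def admissTypeI (n : ℕ) : Set (ℕ × ℕ) :=
  {e | 1 ≤ e.1 ∧ e.1 < e.2 ∧ e.2 ≤ 2 ^ n - 1 ∧ e ∉ (pathP (2 ^ n - 1)).edges ∧
    rankNumber (addEdge (pathP (2 ^ n - 1)) e) = rankNumber (pathP (2 ^ n - 1))}

theorem std_le_iff {x : ℕ} (hx : 0 < x) (p : ℕ) : p + 1 ≤ stdLabel x ↔ 2 ^ p ∣ x := by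
  unfold stdLabel
  rw [padicValNat_dvd_iff_le (by omega)]
  omega

theorem std_eq_of_dvd {x y : ℕ} (hx : 0 < x) (hy : 0 < y)
    (h : ∀ p, 2 ^ p ∣ x ↔ 2 ^ p ∣ y) : stdLabel x = stdLabel y := by
  have h1 := (std_le_iff hx (padicValNat 2 y)).2 ((h _).2 ((std_le_iff hy _).1 le_rfl))
  have h2 := (std_le_iff hy (padicValNat 2 x)).2 ((h _).1 ((std_le_iff hx _).1 le_rfl))
  change stdLabel y ≤ _ at h1
  change stdLabel x ≤ _ at h2
  omega

theorem not_dvd_of_lt {n p x : ℕ} (hx : 0 < x) (hxn : x < 2 ^ n) (h : 2 ^ p ∣ x) : p ≤ n := by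
  have := Nat.le_of_dvd hx h
  exact ((Nat.pow_lt_pow_iff_right (a := 2) (by norm_num)).1 (this.trans_lt hxn)).le

theorem std_add {n x : ℕ} (hx : 0 < x) (hxn : x < 2 ^ n) :
    stdLabel (2 ^ n + x) = stdLabel x := by
  apply std_eq_of_dvd (by omega) hx
  intro p
  constructor
  · intro h
    by_cases hp : p ≤ n
    · exact (Nat.dvd_add_right (pow_dvd_pow 2 hp)).1 h
    · exfalso
      have h1 : 2 ^ n ∣ 2 ^ n + x := (pow_dvd_pow 2 (by omega)).trans h
      have h2 := (Nat.dvd_add_right (dvd_refl _)).1 h1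
      exact absurd (Nat.le_of_dvd hx h2) (by omega)
  · intro h
    exact dvd_add (pow_dvd_pow 2 (not_dvd_of_lt hx hxn h)) h

theorem std_sub {n x : ℕ} (hx : 0 < x) (hxn : x < 2 ^ n) :
    stdLabel (2 ^ n - x) = stdLabel x := by
  have key : ∀ y p, 0 < y → y < 2 ^ n → 2 ^ p ∣ y → 2 ^ p ∣ 2 ^ n - y := by
    intro y p hy hyn h
    exact Nat.dvd_sub (pow_dvd_pow 2 (not_dvd_of_lt hy hyn h)) h
  apply std_eq_of_dvd (by omega) hx
  intro p
  constructor
  · intro h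
    have := key _ p (by omega) (by omega) h
    rwa [Nat.sub_sub_self hxn.le] at this
  · exact key x p hx hxn

theorem std_le_n {n x : ℕ} (hx : 0 < x) (hxn : x < 2 ^ n) : 1 ≤ stdLabel x ∧ stdLabel x ≤ n := by
  refine ⟨by unfold stdLabel; omega, ?_⟩
  have h := (std_le_iff hx (padicValNat 2 x)).1 le_rfl
  have := Nat.le_of_dvd hx h
  have := ((Nat.pow_lt_pow_iff_right (a := 2) (by norm_num)).1 (this.trans_lt hxn))
  unfold stdLabel; omega

theorem std_two_pow (n : ℕ) : stdLabel (2 ^ n) = n + 1 := by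
  simp [stdLabel]

/-- odd decomposition -/
theorem std_decomp {u p : ℕ} (hu : 0 < u) (h : stdLabel u = p + 1) :
    ∃ q, u = 2 ^ p * (2 * q + 1) := by
  have h1 := (std_le_iff hu p).1 h.ge
  have h2 : ¬ 2 ^ (p + 1) ∣ u := fun h3 => by
    have := (std_le_iff hu (p + 1)).2 h3
    omega
  obtain ⟨r, rfl⟩ := h1
  rcases Nat.even_or_odd' r with ⟨q, rfl | rfl⟩
  · exact absurd ⟨q, by ring⟩ h2
  · exact ⟨q, rfl⟩

theorem std_between {u v : ℕ} (hu : 0 < u) (huv : u < v) (h : stdLabel u = stdLabel v) :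
    ∃ x, u < x ∧ x < v ∧ stdLabel u < stdLabel x := by
  obtain ⟨p, hp⟩ : ∃ p, stdLabel u = p + 1 := ⟨_, rfl⟩
  obtain ⟨q, hq⟩ := std_decomp hu hp
  obtain ⟨r, hr⟩ := std_decomp (by omega) (h ▸ hp)
  have h2 : 0 < 2 ^ p := by positivity
  have hqr : q + 1 ≤ r := by
    by_contra hc
    have : 2 ^ p * (2 * r + 1) ≤ 2 ^ p * (2 * q + 1) := Nat.mul_le_mul_left _ (by omega)
    omega
  refine ⟨2 ^ p * (2 * q + 2), ?_, ?_, ?_⟩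
  · rw [hq]; exact Nat.mul_lt_mul_of_pos_left (by omega) h2
  · rw [hr]; exact Nat.mul_lt_mul_of_pos_left (by omega) h2
  · have : p + 1 + 1 ≤ stdLabel (2 ^ p * (2 * q + 2)) :=
      (std_le_iff (by positivity) _).2 ⟨q + 1, by ring⟩
    omega

theorem bit_of_max {u i p : ℕ} (hu : 0 < u) (hui : u ≤ i) (hp : stdLabel u = p + 1)
    (h : ∀ x, u ≤ x → x ≤ i → stdLabel x ≤ p + 1) : i.testBit p = true := by
  obtain ⟨q, hq⟩ := std_decomp hu hp
  have h2 : 0 < 2 ^ p := by positivity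
  have hi : i < 2 ^ p * (2 * q + 2) := by
    by_contra hc
    have h3 : p + 1 + 1 ≤ stdLabel (2 ^ p * (2 * q + 2)) :=
      (std_le_iff (by positivity) _).2 ⟨q + 1, by ring⟩
    have := h (2 ^ p * (2 * q + 2)) (by rw [hq]; exact Nat.mul_le_mul_left _ (by omega)) (by omega)
    omega
  have h4 : i / 2 ^ p = 2 * q + 1 := by
    apply Nat.div_eq_of_lt_le
    · rw [mul_comm, ← hq]; exact hui
    · rw [mul_comm]; exact hi
  rw [Nat.testBit_eq_decide_div_mod_eq, h4]
  simp

theorem max_of_bit {i p : ℕ} (h : i.testBit p = true) :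
    ∃ a, 0 < a ∧ a ≤ i ∧ stdLabel a = p + 1 ∧ ∀ x, a ≤ x → x ≤ i → stdLabel x ≤ p + 1 := by
  rw [Nat.testBit_eq_decide_div_mod_eq] at h
  have h1 : i / 2 ^ p % 2 = 1 := by simpa using h
  have h2 : 0 < 2 ^ p := by positivity
  obtain ⟨q, hq⟩ : ∃ q, i / 2 ^ p = 2 * q + 1 := ⟨i / 2 ^ p / 2, by omega⟩
  have h3 := Nat.div_add_mod i (2 ^ p)
  have h4 := Nat.mod_lt i h2
  rw [hq] at h3
  have key : ∀ x, 2 ^ p * (2 * q + 1) ≤ x → x ≤ i → stdLabel x ≤ p + 1 := by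
    intro x hx hxi
    by_contra hc
    obtain ⟨r, hr⟩ := (std_le_iff (x := x) (by have : 0 < 2 ^ p * (2 * q + 1) := by positivity
                                               omega) (p + 1)).1 (by omega)
    have e : x = 2 ^ p * (2 * r) := by rw [hr]; ring
    have l1 : 2 * q + 1 ≤ 2 * r := by
      rw [e] at hx; exact Nat.le_of_mul_le_mul_left hx h2
    have l2 : 2 * r < 2 * q + 2 := by
      apply Nat.lt_of_mul_lt_mul_left (a := 2 ^ p)
      rw [← e]
      have : 2 ^ p * (2 * q + 2) = 2 ^ p * (2 * q + 1) + 2 ^ p := by ring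
      omega
    omega
  refine ⟨2 ^ p * (2 * q + 1), by positivity, by omega, ?_, key⟩
  have := key _ le_rfl (by omega)
  have := (std_le_iff (x := 2 ^ p * (2 * q + 1)) (by positivity) p).2 ⟨_, rfl⟩
  omega

/-- f restricted to (s, s+m] is a path ranking with k labels -/
def PR (k s m : ℕ) (f : ℕ → ℕ) : Prop :=
  (∀ x, s < x → x < s + m → 1 ≤ f x ∧ f x ≤ k) ∧
  ∀ a b, s < a → a < b → b < s + m → f a = f b → ∃ x, a < x ∧ x < b ∧ f a < f x

theorem PR.left {k s m p : ℕ} {f : ℕ → ℕ} (h : PR (k + 1) s m f) (hs : s < p) (hp : p < s + m)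
    (hf : f p = k + 1) : PR k s (p - s) f ∧ PR k p (s + m - p) f := by
  have ne : ∀ x, s < x → x < s + m → x ≠ p → f x ≤ k := by
    intro x h1 h2 h3
    by_contra hc
    have hx := (h.1 x h1 h2).2
    rcases lt_or_gt_of_ne h3 with h4 | h4
    · obtain ⟨y, y1, y2, y3⟩ := h.2 x p h1 h4 hp (by omega)
      have := (h.1 y (by omega) (by omega)).2
      omega
    · obtain ⟨y, y1, y2, y3⟩ := h.2 p x hs h4 h2 (by omega)
      have := (h.1 y (by omega) (by omega)).2
      omega
  refine ⟨⟨fun x h1 h2 => ⟨(h.1 x h1 (by omega)).1, ne x h1 (by omega) (by omega)⟩,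
    fun a b h1 h2 h3 h4 => h.2 a b h1 h2 (by omega) h4⟩,
    ⟨fun x h1 h2 => ⟨(h.1 x (by omega) (by omega)).1, ne x (by omega) (by omega) (by omega)⟩,
    fun a b h1 h2 h3 h4 => h.2 a b (by omega) h2 (by omega) h4⟩⟩

theorem PR.bound {k : ℕ} : ∀ {s m : ℕ} {f : ℕ → ℕ}, PR k s m f → m ≤ 2 ^ k := by
  induction k with
  | zero =>
    intro s m f h
    by_contra hc
    have := h.1 (s + 1) (by omega) (by simp at hc; omega)
    omega
  | succ k ih =>
    intro s m f h
    rw [pow_succ]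
    by_cases hp : ∃ p, s < p ∧ p < s + m ∧ f p = k + 1
    · obtain ⟨p, h1, h2, h3⟩ := hp
      obtain ⟨ha, hb⟩ := h.left h1 h2 h3
      have := ih ha
      have := ih hb
      omega
    · have : PR k s m f := ⟨fun x h1 h2 => ⟨(h.1 x h1 h2).1, by
        have := (h.1 x h1 h2).2
        have : f x ≠ k + 1 := fun h3 => hp ⟨x, h1, h2, h3⟩
        omega⟩, h.2⟩
      have := ih this
      omega

theorem PR.unique {k : ℕ} : ∀ {s : ℕ} {f : ℕ → ℕ}, PR k s (2 ^ k) f →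
    ∀ x, 0 < x → x < 2 ^ k → f (s + x) = stdLabel x := by
  induction k with
  | zero => intro s f h x h1 h2; simp at h2; omega
  | succ k ih =>
    intro s f h
    have h0 : 0 < 2 ^ k := by positivity
    by_cases hp : ∃ p, s < p ∧ p < s + 2 ^ (k + 1) ∧ f p = k + 1
    · obtain ⟨p, h1, h2, h3⟩ := hp
      obtain ⟨ha, hb⟩ := h.left h1 h2 h3
      have b1 := ha.bound
      have b2 := hb.bound
      rw [pow_succ] at *
      have e1 : p - s = 2 ^ k := by omega
      have e2 : s + 2 ^ k * 2 - p = 2 ^ k := by omega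
      rw [e1] at ha
      rw [e2] at hb
      intro x hx1 hx2
      rcases lt_trichotomy x (2 ^ k) with hx | hx | hx
      · exact ih ha x hx1 hx
      · rw [hx, std_two_pow, ← h3]; congr 1; omega
      · obtain ⟨y, rfl⟩ : ∃ y, x = 2 ^ k + y := ⟨x - 2 ^ k, by omega⟩
        rw [std_add (by omega) (by omega), ← ih hb y (by omega) (by omega)]
        congr 1; omega
    · have : PR k s (2 ^ (k + 1)) f := ⟨fun x h1 h2 => ⟨(h.1 x h1 h2).1, by
        have := (h.1 x h1 h2).2
        have : f x ≠ k + 1 := fun h3 => hp ⟨x, h1, h2, h3⟩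
        omega⟩, h.2⟩
      have := this.bound
      rw [pow_succ] at this
      omega


theorem walk_append {G : DGraph} {u a b v : ℕ} {l₁ l₂ : List ℕ} (h₁ : IsWalkFrom G u a l₁)
    (e : (a, b) ∈ G.edges) (h₂ : IsWalkFrom G b v l₂) : IsWalkFrom G u v (l₁ ++ l₂) := by
  obtain ⟨p1, p2, p3, p4⟩ := h₁
  obtain ⟨q1, q2, q3, q4⟩ := h₂
  refine ⟨?_, ?_, ?_, ?_⟩
  · simp [p1]
  · simp [q2]
  · refine List.isChain_append.2 ⟨p3, q3, ?_⟩
    intro x hx y hy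
    rw [p2] at hx
    rw [q1] at hy
    simp at hx hy
    subst hx; subst hy
    exact e
  · intro x hx
    rcases List.mem_append.1 hx with h | h
    · exact p4 x h
    · exact q4 x h

theorem walk_single {G : DGraph} {u : ℕ} (h : u ∈ G.verts) : IsWalkFrom G u u [u] := by
  refine ⟨rfl, rfl, ?_, ?_⟩
  · exact List.isChain_singleton _
  · intro x hx; simp at hx; rwa [hx]

theorem walk_path (e : ℕ × ℕ) (η u : ℕ) (hu : 1 ≤ u) : ∀ d, u + d ≤ η →
    ∃ l, IsWalkFrom (addEdge (pathP η) e) u (u + d) l ∧ ∀ x ∈ l, u ≤ x ∧ x ≤ u + d := by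
  intro d
  induction d with
  | zero =>
    intro h
    exact ⟨[u], walk_single ⟨hu, by omega⟩, by simp⟩
  | succ d ih =>
    intro h
    obtain ⟨l, hl, hx⟩ := ih (by omega)
    refine ⟨l ++ [u + (d + 1)], walk_append hl ?_ (walk_single ⟨by omega, by omega⟩), ?_⟩
    · exact Or.inr ⟨u + d, by omega, by omega, rfl⟩
    · intro x h
      rcases List.mem_append.1 h with h | h
      · have := hx x h; omega
      · simp at h; omega

theorem ranking_PR {e : ℕ × ℕ} {k N : ℕ} {f : ℕ → ℕ}
    (h : IsRanking (addEdge (pathP (N - 1)) e) k f) : PR k 0 N f := by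
  refine ⟨fun x h1 h2 => h.1 x ⟨h1, by omega⟩, ?_⟩
  intro a b h1 h2 h3 h4
  obtain ⟨l, hl, hx⟩ := walk_path e (N - 1) a h1 (b - a) (by omega)
  rw [show a + (b - a) = b by omega] at hl hx
  obtain ⟨x, x1, x2⟩ := h.2 a ⟨h1, by omega⟩ b ⟨by omega, by omega⟩ (by omega) h4 l hl
  have := hx x x1
  refine ⟨x, ?_, ?_, x2⟩
  · rcases eq_or_lt_of_le this.1 with h | h
    · subst h; omega
    · exact h
  · rcases eq_or_lt_of_le this.2 with h | h
    · subst h; omega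
    · exact h

theorem walk_cover {η i j : ℕ} (hij : i < j) : ∀ (l : List ℕ) (u v : ℕ),
    IsWalkFrom (addEdge (pathP η) (i, j)) u v l →
    (u ≤ v ∧ ∀ x, u ≤ x → x ≤ v → x ∈ l) ∨
    (u ≤ i ∧ j ≤ v ∧ (∀ x, u ≤ x → x ≤ i → x ∈ l) ∧ (∀ x, j ≤ x → x ≤ v → x ∈ l)) := by
  intro l
  induction l with
  | nil => intro u v h; simp [IsWalkFrom] at h
  | cons a t ih =>
    intro u v h
    obtain ⟨h1, h2, h3, h4⟩ := h
    simp at h1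
    subst h1
    cases t with
    | nil =>
      simp at h2
      subst h2
      left
      refine ⟨le_rfl, ?_⟩
      intro x hx1 hx2
      simp; omega
    | cons w t =>
      have hc := List.isChain_cons_cons.1 h3
      have hw : IsWalkFrom (addEdge (pathP η) (i, j)) w v (w :: t) :=
        ⟨rfl, by simpa using h2, hc.2, fun x hx => h4 x (List.mem_cons_of_mem _ hx)⟩
      have IH := ih w v hw
      rcases hc.1 with he | ⟨r, hr1, hr2, he⟩
      · simp only [Prod.mk.injEq] at he
        obtain ⟨rfl, rfl⟩ := he
        rcases IH with ⟨c1, c2⟩ | ⟨c1, _⟩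
        · right
          refine ⟨le_rfl, c1, ?_, fun x hx1 hx2 => List.mem_cons_of_mem _ (c2 x hx1 hx2)⟩
          intro x hx1 hx2
          have : x = a := by omega
          simp [this]
        · omega
      · simp only [Prod.mk.injEq] at he
        obtain ⟨rfl, rfl⟩ := he
        rcases IH with ⟨c1, c2⟩ | ⟨c1, c2, c3, c4⟩
        · left
          refine ⟨by omega, ?_⟩
          intro x hx1 hx2
          rcases eq_or_lt_of_le hx1 with h | h
          · simp [h]
          · exact List.mem_cons_of_mem _ (c2 x h hx2)
        · right
          refine ⟨by omega, c2, ?_, fun x hx1 hx2 => List.mem_cons_of_mem _ (c4 x hx1 hx2)⟩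
          intro x hx1 hx2
          rcases eq_or_lt_of_le hx1 with h | h
          · simp [h]
          · exact List.mem_cons_of_mem _ (c3 x h hx2)

theorem and_zero_iff (a b : ℕ) : a &&& b = 0 ↔ ∀ p, ¬ (a.testBit p = true ∧ b.testBit p = true) := by
  constructor
  · intro h p ⟨h1, h2⟩
    have := Nat.testBit_and a b p
    rw [h, h1, h2] at this
    simp at this
  · intro h
    apply Nat.eq_of_testBit_eq
    intro p
    have := h p
    rw [Nat.testBit_and]
    simp at this ⊢
    exact this

theorem std_ranking {n i j : ℕ} (hij : i < j) (hj : j < 2 ^ n)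
    (h : i &&& (2 ^ n - j) = 0) : IsRanking (addEdge (pathP (2 ^ n - 1)) (i, j)) n stdLabel := by
  have hv : ∀ x, x ∈ (addEdge (pathP (2 ^ n - 1)) (i, j)).verts → 0 < x ∧ x < 2 ^ n := by
    intro x hx
    have h1 : 1 ≤ x := hx.1
    have h2 : x ≤ 2 ^ n - 1 := hx.2
    omega
  refine ⟨fun x hx => std_le_n (hv x hx).1 (hv x hx).2, ?_⟩
  intro u hu v hv' huv hf l hl
  have hu := hv u hu
  have hv := hv v hv'
  rcases walk_cover hij l u v hl with ⟨h1, h2⟩ | ⟨h1, h2, h3, h4⟩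
  · obtain ⟨x, x1, x2, x3⟩ := std_between hu.1 (by omega : u < v) hf
    exact ⟨x, h2 x x1.le x2.le, x3⟩
  · by_contra hc
    push Not at hc
    obtain ⟨p, hp⟩ : ∃ p, stdLabel u = p + 1 := ⟨_, rfl⟩
    refine (and_zero_iff _ _).1 h p ⟨?_, ?_⟩
    · exact bit_of_max hu.1 h1 hp fun x hx1 hx2 => hp ▸ hc x (h3 x hx1 hx2)
    · refine bit_of_max (u := 2 ^ n - v) (by omega) (by omega) ?_ ?_
      · rw [std_sub hv.1 hv.2]; omega
      · intro x hx1 hx2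
        rw [← std_sub (n := n) (x := x) (by omega) (by omega), ← hp]
        exact hc _ (h4 _ (by omega) (by omega))

theorem ranking_and {n i j : ℕ} {f : ℕ → ℕ} (hi : 1 ≤ i) (hij : i < j) (hj : j < 2 ^ n)
    (h : IsRanking (addEdge (pathP (2 ^ n - 1)) (i, j)) n f) : i &&& (2 ^ n - j) = 0 := by
  have hf := (ranking_PR h).unique
  simp only [zero_add] at hf
  rw [and_zero_iff]
  rintro p ⟨h1, h2⟩
  obtain ⟨a, a1, a2, a3, a4⟩ := max_of_bit h1
  obtain ⟨b, b1, b2, b3, b4⟩ := max_of_bit h2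
  obtain ⟨l, hl, hx⟩ := walk_path (i, j) (2 ^ n - 1) a a1 (i - a) (by omega)
  obtain ⟨l', hl', hx'⟩ := walk_path (i, j) (2 ^ n - 1) j (by omega) (2 ^ n - b - j) (by omega)
  rw [show a + (i - a) = i by omega] at hl hx
  rw [show j + (2 ^ n - b - j) = 2 ^ n - b by omega] at hl' hx'
  have hw := walk_append hl (Or.inl rfl) hl'
  have fa := hf a a1 (by omega)
  have fb := hf (2 ^ n - b) (by omega) (by omega)
  rw [std_sub b1 (by omega)] at fb
  obtain ⟨x, x1, x2⟩ := h.2 a ⟨a1, by omega⟩ (2 ^ n - b) ⟨by omega, by omega⟩ (by omega)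
    (by omega) _ hw
  rcases List.mem_append.1 x1 with hm | hm
  · have := hx x hm
    rw [hf x (by omega) (by omega)] at x2
    have := a4 x (by omega) (by omega)
    omega
  · have := hx' x hm
    rw [hf x (by omega) (by omega), ← std_sub (n := n) (by omega) (by omega)] at x2
    have := b4 (2 ^ n - x) (by omega) (by omega)
    omega

theorem ranking_mono {G : DGraph} {e : ℕ × ℕ} {k : ℕ} {f : ℕ → ℕ}
    (h : IsRanking (addEdge G e) k f) : IsRanking G k f := by
  refine ⟨h.1, ?_⟩
  intro u hu v hv h1 h2 l hl
  exact h.2 u hu v hv h1 h2 l ⟨hl.1, hl.2.1, hl.2.2.1.imp fun a b h => Or.inr h, hl.2.2.2⟩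

theorem addEdge_mem {G : DGraph} {e : ℕ × ℕ} (he : e ∈ G.edges) : addEdge G e = G := by
  cases G
  simp only [addEdge, DGraph.mk.injEq, true_and]
  exact Set.insert_eq_of_mem he

theorem pow_bound {k n : ℕ} {e : ℕ × ℕ} {f : ℕ → ℕ}
    (h : IsRanking (addEdge (pathP (2 ^ n - 1)) e) k f) : n ≤ k :=
  (Nat.pow_le_pow_iff_right (by norm_num)).1 (ranking_PR h).bound

theorem rank_eq_iff {n : ℕ} (hn : 2 ≤ n) {e : ℕ × ℕ} :
    rankNumber (addEdge (pathP (2 ^ n - 1)) e) = n ↔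
      ∃ f, IsRanking (addEdge (pathP (2 ^ n - 1)) e) n f := by
  constructor
  · intro h
    have hne : {k | ∃ f : ℕ → ℕ, IsRanking (addEdge (pathP (2 ^ n - 1)) e) k f}.Nonempty := by
      apply Nat.nonempty_of_pos_sInf
      change 0 < rankNumber _
      omega
    have := Nat.sInf_mem hne
    change rankNumber _ ∈ _ at this
    rw [h] at this
    exact this
  · intro h
    apply le_antisymm
    · exact Nat.sInf_le h
    · apply le_csInf ⟨n, h⟩
      rintro k ⟨f, hf⟩
      exact pow_bound hf

theorem comp_and {n a : ℕ} (ha : a < 2 ^ n) : a &&& (2 ^ n - (a + 1)) = 0 := by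
  rw [and_zero_iff]
  intro p
  rw [Nat.testBit_two_pow_sub_succ ha]
  simp
  exact fun h _ => h

theorem rank_path {n : ℕ} (hn : 2 ≤ n) : rankNumber (pathP (2 ^ n - 1)) = n := by
  have h4 : 4 ≤ 2 ^ n := by
    calc 4 = 2 ^ 2 := rfl
      _ ≤ 2 ^ n := Nat.pow_le_pow_right (by norm_num) hn
  have : (1, 2) ∈ (pathP (2 ^ n - 1)).edges := ⟨1, le_rfl, by omega, rfl⟩
  rw [← addEdge_mem this]
  exact (rank_eq_iff hn).2 ⟨_, std_ranking (by norm_num) (by omega) (comp_and (by omega))⟩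

theorem admiss_iff {n : ℕ} (hn : 2 ≤ n) (i j : ℕ) : (i, j) ∈ admissTypeI n ↔
    1 ≤ i ∧ i + 1 < j ∧ j < 2 ^ n ∧ i &&& (2 ^ n - j) = 0 := by
  have h0 : 0 < 2 ^ n := by positivity
  simp only [admissTypeI, Set.mem_setOf_eq, rank_path hn, rank_eq_iff hn]
  constructor
  · rintro ⟨h1, h2, h3, h4, f, hf⟩
    refine ⟨h1, ?_, by omega, ranking_and h1 h2 (by omega) hf⟩
    by_contra hc
    exact h4 ⟨i, h1, by omega, by simp; omega⟩
  · rintro ⟨h1, h2, h3, h4⟩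
    refine ⟨h1, by omega, by omega, ?_, _, std_ranking (by omega) h3 h4⟩
    rintro ⟨r, _, _, hr⟩
    simp at hr
    omega

/-! counting -/

def cnt (n : ℕ) : ℕ :=
  ∑ i ∈ Finset.range (2 ^ n), ∑ m ∈ Finset.range (2 ^ n), if i &&& m = 0 then 1 else 0

theorem sum_double (f : ℕ → ℕ) (N : ℕ) : ∑ i ∈ Finset.range (N * 2), f i =
    ∑ i ∈ Finset.range N, (f (2 * i) + f (2 * i + 1)) := by
  induction N with
  | zero => simp
  | succ N ih =>
    rw [Finset.sum_range_succ, ← ih, show (N + 1) * 2 = N * 2 + 1 + 1 by ring,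
      Finset.sum_range_succ, Finset.sum_range_succ, mul_comm N 2]
    ring

theorem and_split (a b : ℕ) : a &&& b = 0 ↔
    (a / 2 &&& b / 2 = 0) ∧ ¬ (a % 2 = 1 ∧ b % 2 = 1) := by
  simp only [and_zero_iff]
  constructor
  · intro h
    refine ⟨fun p => ?_, ?_⟩
    · have := h (p + 1)
      rwa [Nat.testBit_succ, Nat.testBit_succ] at this
    · have := h 0
      simpa [Nat.testBit_zero] using this
  · rintro ⟨h1, h2⟩ p
    cases p with
    | zero => simpa [Nat.testBit_zero] using h2
    | succ p => rw [Nat.testBit_succ, Nat.testBit_succ]; exact h1 p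

theorem cnt_eq (n : ℕ) : cnt n = 3 ^ n := by
  induction n with
  | zero => simp [cnt]
  | succ n ih =>
    unfold cnt at *
    rw [pow_succ 2 n, sum_double]
    simp only [sum_double]
    rw [pow_succ, ← ih, Finset.sum_mul]
    refine Finset.sum_congr rfl fun i _ => ?_
    rw [Finset.sum_mul, ← Finset.sum_add_distrib]
    refine Finset.sum_congr rfl fun m _ => ?_
    have e1 : (2 * i) &&& (2 * m) = 0 ↔ i &&& m = 0 := by rw [and_split]; simp
    have e2 : (2 * i) &&& (2 * m + 1) = 0 ↔ i &&& m = 0 := by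
      rw [and_split, show (2 * m + 1) / 2 = m by omega]; simp
    have e3 : (2 * i + 1) &&& (2 * m) = 0 ↔ i &&& m = 0 := by
      rw [and_split, show (2 * i + 1) / 2 = i by omega]; simp
    have e4 : ¬ (2 * i + 1) &&& (2 * m + 1) = 0 := by
      rw [and_split]; omega
    simp only [e1, e2, e3, e4, if_false]
    split_ifs <;> rfl

theorem add_lt {n : ℕ} : ∀ {a b : ℕ}, a < 2 ^ n → b < 2 ^ n → a &&& b = 0 → a + b < 2 ^ n := by
  induction n with
  | zero => intro a b h1 h2 _; simp at *; omega
  | succ n ih =>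
    intro a b h1 h2 h
    rw [and_split] at h
    rw [pow_succ] at *
    have := ih (a := a / 2) (b := b / 2) (by omega) (by omega) h.1
    omega

open Finset in
theorem admiss_card {n : ℕ} (hn : 2 ≤ n) :
    (admissTypeI n).ncard + 3 * 2 ^ n = 3 ^ n + 3 := by
  have h4 : 4 ≤ 2 ^ n := by
    calc 4 = 2 ^ 2 := rfl
      _ ≤ 2 ^ n := Nat.pow_le_pow_right (by norm_num) hn
  set N := 2 ^ n with hN
  let D : Finset (ℕ × ℕ) := (range N ×ˢ range N).filter fun p => p.1 &&& p.2 = 0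
  have hD : D.card = 3 ^ n := by
    rw [← cnt_eq, cnt, Finset.card_filter, Finset.sum_product]
  let E := D.filter fun p => 1 ≤ p.1 ∧ 1 ≤ p.2 ∧ p.1 + p.2 + 1 < N
  have hE : (admissTypeI n).ncard = E.card := by
    rw [← Set.ncard_coe_finset]
    refine Set.ncard_congr (fun p _ => (p.1, N - p.2)) ?_ ?_ ?_
    · rintro ⟨i, j⟩ h
      rw [admiss_iff hn] at h
      simp only [E, D, coe_filter, mem_filter, mem_product, mem_range, Set.mem_setOf_eq]
      refine ⟨⟨⟨?_, ?_⟩, h.2.2.2⟩, ?_⟩ <;> omega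
    · rintro ⟨i, j⟩ ⟨i', j'⟩ h h' e
      rw [admiss_iff hn] at h h'
      simp only [Prod.mk.injEq] at e ⊢
      omega
    · rintro ⟨i, m⟩ h
      simp only [E, D, coe_filter, mem_filter, mem_product, mem_range, Set.mem_setOf_eq] at h
      refine ⟨(i, N - m), ?_, ?_⟩
      · rw [admiss_iff hn, ← hN, Nat.sub_sub_self (by omega)]
        refine ⟨?_, ?_, ?_, h.1.2⟩ <;> omega
      · simp only [Prod.mk.injEq, true_and]; omega
  let A : Finset (ℕ × ℕ) := (range N).image fun i => (i, 0)
  let B : Finset (ℕ × ℕ) := (Icc 1 (N - 1)).image fun m => (0, m)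
  let C : Finset (ℕ × ℕ) := (Icc 1 (N - 2)).image fun i => (i, N - (i + 1))
  have hA : A.card = N := by
    rw [card_image_of_injective _ (fun a b h => by simpa using h), card_range]
  have hB : B.card = N - 1 := by
    rw [card_image_of_injective _ (fun a b h => by simpa using h), Nat.card_Icc]; omega
  have hC : C.card = N - 2 := by
    rw [card_image_of_injective _ (fun a b h => by simp at h; exact h.1), Nat.card_Icc]; omega
  have hAB : Disjoint A B := by
    rw [Finset.disjoint_left]
    rintro ⟨a, b⟩ h h'
    simp [A, B] at h h'
    omega
  have hABC : Disjoint (A ∪ B) C := by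
    rw [Finset.disjoint_left]
    rintro ⟨a, b⟩ h h'
    simp [A, B, C] at h h'
    omega
  have hF : D.filter (fun p => ¬ (1 ≤ p.1 ∧ 1 ≤ p.2 ∧ p.1 + p.2 + 1 < N)) = A ∪ B ∪ C := by
    ext ⟨a, b⟩
    simp only [D, A, B, C, mem_filter, mem_product, mem_range, mem_union, mem_image, mem_Icc,
      Prod.mk.injEq]
    constructor
    · rintro ⟨⟨⟨h1, h2⟩, h3⟩, h⟩
      have := add_lt h1 h2 h3
      by_cases hb : b = 0
      · exact Or.inl (Or.inl ⟨a, h1, rfl, hb.symm⟩)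
      by_cases ha : a = 0
      · exact Or.inl (Or.inr ⟨b, by omega, ha.symm, rfl⟩)
      · exact Or.inr ⟨a, by omega, rfl, by omega⟩
    · rintro ((⟨x, h1, rfl, rfl⟩ | ⟨x, h1, rfl, rfl⟩) | ⟨x, h1, rfl, rfl⟩)
      · exact ⟨⟨⟨h1, by omega⟩, by simp⟩, by omega⟩
      · exact ⟨⟨⟨by omega, by omega⟩, by simp⟩, by omega⟩
      · exact ⟨⟨⟨by omega, by omega⟩, comp_and (by omega)⟩, by omega⟩
  have key := Finset.card_filter_add_card_filter_not (s := D)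
    (fun p : ℕ × ℕ => 1 ≤ p.1 ∧ 1 ≤ p.2 ∧ p.1 + p.2 + 1 < N)
  rw [hF, card_union_of_disjoint hABC, card_union_of_disjoint hAB, hA, hB, hC, hD] at key
  rw [hE]
  change E.card + _ = _ at key
  omega

theorem st1 (n : ℕ) : stirling (n + 1) 1 = 1 := by
  induction n with
  | zero => rfl
  | succ n ih => 
    have : stirling (n + 1 + 1) 1 = 1 * stirling (n + 1) 1 + stirling (n + 1) 0 := rfl
    rw [this, ih]; rfl

theorem st2 (n : ℕ) : stirling (n + 1) 2 + 1 = 2 ^ n := by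
  induction n with
  | zero => rfl
  | succ n ih =>
    have : stirling (n + 1 + 1) 2 = 2 * stirling (n + 1) 2 + stirling (n + 1) 1 := rfl
    rw [this, st1, pow_succ, ← ih]; ring

theorem st3 (n : ℕ) : 2 * stirling (n + 1) 3 + 2 * 2 ^ n = 3 ^ n + 1 := by
  induction n with
  | zero => rfl
  | succ n ih =>
    have : stirling (n + 1 + 1) 3 = 3 * stirling (n + 1) 3 + stirling (n + 1) 2 := rfl
    have := st2 n
    rw [pow_succ, pow_succ]; omega

/-- For `n ≥ 2`, the number of admissible added edges of type I for
`→P_{2^n−1}` equals `3^n − 3·2^n + 3 = 2(S(n+1,3) − S(n,2))`. -/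
theorem stmt_5 (n : ℕ) (hn : 2 ≤ n) :
    (admissTypeI n).ncard = 3 ^ n + 3 - 3 * 2 ^ n ∧
    (admissTypeI n).ncard = 2 * (stirling (n + 1) 3 - stirling n 2) := by
  have h1 := admiss_card hn
  have h3 := st3 n
  obtain ⟨m, rfl⟩ : ∃ m, n = m + 1 := ⟨n - 1, by omega⟩
  have h2 := st2 m
  have h4 : 2 ^ (m + 1) = 2 * 2 ^ m := by ring
  omega
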